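/- arXiv:1507.03297 — 3 statements merged into one kernel-verified Lean document; each statement's English description precedes it below -/
import Mathlib

section
/- Let p be a prime, let |·|_p be the p-adic absolute value on ℚ_p, and let μ be the Haar measure on ℚ_p normalized so that μ(ℤ_p) = 1. Let k ∈ ℤ and set c = p^{−k} (a positive real number). Then for all real numbers s, a with s > a > 0, ∫_{ℚ_p} max(c, |t|_p)^{−s} · |t|_p^{a−1} dμ(t) = (1 − p^{−1}) · c^{a−s} · (1 − p^{−s}) / ((1 − p^{−a})·(1 − p^{−(s−a)})), and in particular the integrand is integrable. -/
open MeasureTheory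

open Metric

namespace Padic

variable {p : ℕ} [hp : Fact p.Prime]

lemma closedBall_zpow_add_one (n : ℤ) :
    closedBall (0 : ℚ_[p]) ((p : ℝ) ^ (n + 1)) =
      ⋃ i ∈ Finset.range p, closedBall ((i : ℚ_[p]) * (p : ℚ_[p]) ^ (-(n + 1))) ((p : ℝ) ^ n) := by
  have hp0 : (p : ℚ_[p]) ≠ 0 := Nat.cast_ne_zero.2 hp.out.ne_zero
  have hpr : (0 : ℝ) < p := Nat.cast_pos.2 hp.out.pos
  ext t
  simp only [mem_closedBall_iff_norm, sub_zero, Set.mem_iUnion, Finset.mem_range, exists_prop]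
  constructor
  · intro ht
    have hu : ‖t * (p : ℚ_[p]) ^ (n + 1)‖ ≤ 1 := by
      rw [norm_mul, norm_p_zpow, zpow_neg, ← div_eq_mul_inv]
      exact div_le_one_of_le₀ ht (by positivity)
    obtain ⟨i, hi, hmem⟩ := PadicInt.exists_mem_range (⟨_, hu⟩ : ℤ_[p])
    refine ⟨i, hi, ?_⟩
    have h1 : ‖t * (p : ℚ_[p]) ^ (n + 1) - i‖ < 1 := by
      exact PadicInt.mem_nonunits.1 ((IsLocalRing.mem_maximalIdeal _).1 hmem)
    rw [norm_le_pow_iff_norm_lt_pow_add_one]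
    have h2 : t - (i : ℚ_[p]) * (p : ℚ_[p]) ^ (-(n + 1)) =
        (t * (p : ℚ_[p]) ^ (n + 1) - i) * (p : ℚ_[p]) ^ (-(n + 1)) := by
      rw [sub_mul, mul_assoc, ← zpow_add₀ hp0]
      simp
    rw [h2, norm_mul, norm_p_zpow, neg_neg]
    exact mul_lt_of_lt_one_left (by positivity) h1
  · rintro ⟨i, -, h⟩
    have h1 : ‖(i : ℚ_[p]) * (p : ℚ_[p]) ^ (-(n + 1))‖ ≤ (p : ℝ) ^ (n + 1) := by
      rw [norm_mul, norm_p_zpow, neg_neg]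
      exact mul_le_of_le_one_left (by positivity) (by simpa using norm_int_le_one (p := p) i)
    have h2 : (p : ℝ) ^ n ≤ (p : ℝ) ^ (n + 1) :=
      zpow_le_zpow_right₀ (by exact_mod_cast hp.out.one_le) (by lia)
    have h3 := nonarchimedean (t - (i : ℚ_[p]) * (p : ℚ_[p]) ^ (-(n + 1)))
      ((i : ℚ_[p]) * (p : ℚ_[p]) ^ (-(n + 1)))
    rw [sub_add_cancel] at h3
    exact h3.trans (max_le (h.trans h2) h1)

lemma pairwiseDisjoint_closedBall_zpow (n : ℤ) :
    ((Finset.range p : Finset ℕ) : Set ℕ).PairwiseDisjoint fun i : ℕ =>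
      closedBall ((i : ℚ_[p]) * (p : ℚ_[p]) ^ (-(n + 1))) ((p : ℝ) ^ n) := by
  have hpr : (0 : ℝ) < p := Nat.cast_pos.2 hp.out.pos
  intro i hi j hj hij
  simp only [Finset.coe_range, Set.mem_Iio] at hi hj
  refine Set.disjoint_left.2 fun t hti htj => hij ?_
  rw [mem_closedBall, dist_eq_norm] at hti htj
  have h1 : ‖((i : ℤ) - (j : ℤ) : ℚ_[p]) * (p : ℚ_[p]) ^ (-(n + 1))‖ ≤ (p : ℝ) ^ n := by
    have h := nonarchimedean (t - (j : ℚ_[p]) * (p : ℚ_[p]) ^ (-(n + 1)))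
      (-(t - (i : ℚ_[p]) * (p : ℚ_[p]) ^ (-(n + 1))))
    rw [norm_neg] at h
    refine le_trans (le_of_eq ?_) (h.trans (max_le htj hti))
    congr 1
    push_cast
    ring
  rw [norm_le_pow_iff_norm_lt_pow_add_one, norm_mul, norm_p_zpow, neg_neg] at h1
  have h2 : ‖(((i : ℤ) - (j : ℤ) : ℤ) : ℚ_[p])‖ < 1 := by
    push_cast at h1 ⊢
    exact (mul_lt_iff_lt_one_left (by positivity)).1 h1
  rw [norm_intCast_lt_one_iff] at h2
  have h3 := Int.eq_zero_of_abs_lt_dvd h2 (by rw [abs_lt]; constructor <;> lia)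
  lia

section Measure

variable [MeasurableSpace ℚ_[p]] [BorelSpace ℚ_[p]] (μ : Measure ℚ_[p]) [μ.IsAddHaarMeasure]

lemma addHaar_real_closedBall_zpow_add_one (n : ℤ) :
    μ.real (closedBall (0 : ℚ_[p]) ((p : ℝ) ^ (n + 1))) =
      p * μ.real (closedBall (0 : ℚ_[p]) ((p : ℝ) ^ n)) := by
  rw [Measure.real, closedBall_zpow_add_one, measure_biUnion_finset
    (pairwiseDisjoint_closedBall_zpow n) fun _ _ => measurableSet_closedBall]
  simp_rw [Measure.addHaar_closedBall_center]
  simp [Measure.real]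

variable {μ}

lemma addHaar_real_closedBall_zpow (hμ : μ (closedBall (0 : ℚ_[p]) 1) = 1) (n : ℤ) :
    μ.real (closedBall (0 : ℚ_[p]) ((p : ℝ) ^ n)) = (p : ℝ) ^ n := by
  have hp0 : (p : ℝ) ≠ 0 := Nat.cast_ne_zero.2 hp.out.ne_zero
  induction n with
  | zero => simp [Measure.real, hμ]
  | succ n ih => rw [addHaar_real_closedBall_zpow_add_one, ih, zpow_add_one₀ hp0, mul_comm]
  | pred n ih =>
    have h := addHaar_real_closedBall_zpow_add_one μ (-(n : ℤ) - 1)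
    rw [sub_add_cancel, ih] at h
    rw [← mul_right_inj' hp0, ← h, mul_comm, ← zpow_add_one₀ hp0, sub_add_cancel]

lemma addHaar_real_sphere_zpow (hμ : μ (closedBall (0 : ℚ_[p]) 1) = 1) (n : ℤ) :
    μ.real (sphere (0 : ℚ_[p]) ((p : ℝ) ^ n)) = (1 - (p : ℝ)⁻¹) * (p : ℝ) ^ n := by
  have hp0 : (p : ℝ) ≠ 0 := Nat.cast_ne_zero.2 hp.out.ne_zero
  have hball : ball (0 : ℚ_[p]) ((p : ℝ) ^ n) = closedBall 0 ((p : ℝ) ^ (n - 1)) := by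
    ext t
    simpa using norm_lt_pow_iff_norm_le_pow_sub_one t n
  have hsub : closedBall (0 : ℚ_[p]) ((p : ℝ) ^ (n - 1)) ⊆ closedBall 0 ((p : ℝ) ^ n) :=
    hball ▸ ball_subset_closedBall
  rw [← closedBall_sdiff_ball, hball, measureReal_sdiff hsub measurableSet_closedBall
    measure_closedBall_lt_top.ne, addHaar_real_closedBall_zpow hμ,
    addHaar_real_closedBall_zpow hμ, zpow_sub_one₀ hp0]
  ring

/-- The Haar integral over `ℚ_p` of a nonnegative radial function, as a sum over spheres. -/
lemma integrable_and_integral_comp_norm (hμ : μ (closedBall (0 : ℚ_[p]) 1) = 1)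
    {g : ℝ → ℝ} (hg : ∀ x, 0 ≤ x → 0 ≤ g x) {v : ℝ}
    (hv : HasSum (fun n : ℤ => (1 - (p : ℝ)⁻¹) * (p : ℝ) ^ n * g ((p : ℝ) ^ n)) v) :
    Integrable (fun t : ℚ_[p] => g ‖t‖) μ ∧ ∫ t : ℚ_[p], g ‖t‖ ∂μ = v := by
  have hp1 : (1 : ℝ) < p := by exact_mod_cast hp.out.one_lt
  have hU : (⋃ n : ℤ, sphere (0 : ℚ_[p]) ((p : ℝ) ^ n)) = {0}ᶜ := by
    ext t
    simp only [Set.mem_iUnion, mem_sphere_zero_iff_norm, Set.mem_compl_iff, Set.mem_singleton_iff]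
    refine ⟨?_, fun ht => ⟨_, norm_eq_zpow_neg_valuation ht⟩⟩
    rintro ⟨n, hn⟩ rfl
    rw [norm_zero] at hn
    exact (zpow_pos (zero_lt_one.trans hp1) n).ne hn
  have hae : μ.restrict (⋃ n : ℤ, sphere (0 : ℚ_[p]) ((p : ℝ) ^ n)) = μ := by
    rw [hU, Measure.restrict_eq_self_of_ae_mem]
    simp [ae_iff]
  have hms (n : ℤ) : MeasurableSet (sphere (0 : ℚ_[p]) ((p : ℝ) ^ n)) :=
    isClosed_sphere.measurableSet
  have heq (n : ℤ) : Set.EqOn (fun t : ℚ_[p] => g ‖t‖) (fun _ => g ((p : ℝ) ^ n))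
      (sphere (0 : ℚ_[p]) ((p : ℝ) ^ n)) := fun t ht => by
    simp only [mem_sphere_zero_iff_norm.1 ht]
  have hint (n : ℤ) : ∫ t in sphere (0 : ℚ_[p]) ((p : ℝ) ^ n), g ‖t‖ ∂μ =
      (1 - (p : ℝ)⁻¹) * (p : ℝ) ^ n * g ((p : ℝ) ^ n) := by
    rw [setIntegral_congr_fun (hms n) (heq n), setIntegral_const, addHaar_real_sphere_zpow hμ,
      smul_eq_mul]
  have hon : IntegrableOn (fun t : ℚ_[p] => g ‖t‖) (⋃ n : ℤ, sphere 0 ((p : ℝ) ^ n)) μ := by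
    refine integrableOn_iUnion_of_summable_integral_norm (fun n => ?_) ?_
    · rw [integrableOn_congr_fun (heq n) (hms n)]
      exact integrableOn_const ((isCompact_sphere _ _).measure_lt_top.ne)
    · simpa only [Real.norm_of_nonneg (hg _ (norm_nonneg _)), hint] using hv.summable
  have hsum := hasSum_integral_iUnion hms (fun m n hmn => Set.disjoint_left.2 fun t hm hn =>
    hmn (zpow_right_injective₀ (zero_lt_one.trans hp1) hp1.ne'
      ((mem_sphere_zero_iff_norm.1 hm).symm.trans (mem_sphere_zero_iff_norm.1 hn)))) hon
  rw [IntegrableOn, hae] at hon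
  rw [hae] at hsum
  simp only [hint] at hsum
  exact ⟨hon, hsum.unique hv⟩

end Measure

end Padic

lemma hasSum_max_one_zpow_rpow {q s a : ℝ} (hq : 1 < q) (ha : 0 < a) (has : a < s) :
    HasSum (fun n : ℤ => (max 1 (q ^ n)) ^ (-s) * (q ^ n) ^ a)
      ((1 - q ^ (-s)) / ((1 - q ^ (-a)) * (1 - q ^ (-(s - a))))) := by
  have hq0 : 0 < q := zero_lt_one.trans hq
  have hx : q ^ (-a) < 1 := Real.rpow_lt_one_of_one_lt_of_neg hq (by linarith)
  have hy : q ^ (-(s - a)) < 1 := Real.rpow_lt_one_of_one_lt_of_neg hq (by linarith)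
  have hxy : q ^ (-s) = q ^ (-a) * q ^ (-(s - a)) := by
    rw [← Real.rpow_add hq0]
    ring_nf
  have hnonneg := hasSum_geometric_of_lt_one (Real.rpow_pos_of_pos hq0 _).le hy
  have hneg := (hasSum_geometric_of_lt_one (Real.rpow_pos_of_pos hq0 _).le hx).mul_left (q ^ (-a))
  have hv : (1 - q ^ (-s)) / ((1 - q ^ (-a)) * (1 - q ^ (-(s - a)))) =
      (1 - q ^ (-(s - a)))⁻¹ + q ^ (-a) * (1 - q ^ (-a))⁻¹ := by
    have h1 := (sub_pos.2 hx).ne'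
    have h2 := (sub_pos.2 hy).ne'
    rw [hxy]
    field_simp
    ring
  rw [hv]
  refine HasSum.of_nat_of_neg_add_one ?_ ?_
  · refine hnonneg.congr_fun fun n => ?_
    rw [zpow_natCast, max_eq_right (one_le_pow₀ hq.le), ← Real.rpow_add (by positivity),
      ← Real.rpow_natCast, ← Real.rpow_natCast, ← Real.rpow_mul hq0.le, ← Real.rpow_mul hq0.le]
    ring_nf
  · refine hneg.congr_fun fun n => ?_
    rw [max_eq_left (zpow_le_one_of_nonpos₀ hq.le (by lia)), Real.one_rpow, one_mul,
      ← Real.rpow_intCast, ← Real.rpow_natCast, ← Real.rpow_mul hq0.le, ← Real.rpow_mul hq0.le,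
      ← Real.rpow_add hq0]
    push_cast
    ring_nf

/-- The local `p`-adic integral: with `μ` the additive Haar measure on `ℚ_p` normalized by
`μ(ℤ_p) = 1` and `c = p^{−k}`, for real `s > a > 0` one has
`∫_{ℚ_p} max(c, |t|_p)^{−s} |t|_p^{a−1} dμ(t)
  = (1 − p⁻¹) · c^{a−s} · (1 − p^{−s}) / ((1 − p^{−a})(1 − p^{−(s−a)}))`,
and the integrand is integrable. -/
theorem padic_local_integral (p : ℕ) [Fact p.Prime]
    [MeasurableSpace ℚ_[p]] [BorelSpace ℚ_[p]]
    (μ : Measure ℚ_[p]) [μ.IsAddHaarMeasure]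
    (hμ : μ (Metric.closedBall (0 : ℚ_[p]) 1) = 1)
    (k : ℤ) (c : ℝ) (hc : c = (p : ℝ) ^ (-k))
    (s a : ℝ) (ha : 0 < a) (has : a < s) :
    Integrable (fun t : ℚ_[p] => (max c ‖t‖) ^ (-s) * ‖t‖ ^ (a - 1)) μ ∧
    ∫ t : ℚ_[p], (max c ‖t‖) ^ (-s) * ‖t‖ ^ (a - 1) ∂μ =
      (1 - (p : ℝ)⁻¹) * c ^ (a - s) * (1 - (p : ℝ) ^ (-s)) /
        ((1 - (p : ℝ) ^ (-a)) * (1 - (p : ℝ) ^ (-(s - a)))) := by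
  have hp1 : (1 : ℝ) < p := by exact_mod_cast (Fact.out : p.Prime).one_lt
  have hp0 : (0 : ℝ) < p := zero_lt_one.trans hp1
  have hc0 : 0 < c := hc ▸ zpow_pos hp0 _
  refine Padic.integrable_and_integral_comp_norm hμ
    (g := fun x => (max c x) ^ (-s) * x ^ (a - 1)) (fun x hx => by positivity) ?_
  rw [← (Equiv.subRight k).hasSum_iff, mul_div_assoc]
  refine ((hasSum_max_one_zpow_rpow hp1 ha has).mul_left _).congr_fun fun n => ?_
  have hn : (0 : ℝ) < (p : ℝ) ^ n := zpow_pos hp0 n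
  have hnk : (p : ℝ) ^ (n - k) = c * (p : ℝ) ^ n := by
    rw [hc, ← zpow_add₀ hp0.ne', neg_add_eq_sub]
  have hmax : max c (c * (p : ℝ) ^ n) = c * max 1 ((p : ℝ) ^ n) := by
    rw [mul_max_of_nonneg _ _ hc0.le, mul_one]
  simp only [Function.comp_apply, Equiv.subRight_apply, hnk, hmax]
  rw [Real.mul_rpow hc0.le (by positivity), Real.mul_rpow hc0.le hn.le, Real.rpow_sub_one hc0.ne',
    Real.rpow_sub_one hn.ne', sub_eq_add_neg a s, Real.rpow_add hc0]
  field_simp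
end

section
/- Let K be a field and V a finite-dimensional K-vector space equipped with a nondegenerate alternating bilinear form ω (a symplectic space). Then for any two nonzero vectors u, v ∈ V there exists a linear automorphism g of V preserving ω (i.e., ω(g x, g y) = ω(x, y) for all x, y ∈ V) such that g u = v. In particular the symplectic group of (V, ω) acts transitively on the set of nonzero vectors, and hence on the set of (automatically isotropic) lines in V. -/
/-- If `ω u v ≠ 0`, a symplectic transvection along `v - u` sends `u` to `v`. -/
theorem exists_isometry_of_apply_ne_zero
    {K V : Type*} [Field K] [AddCommGroup V] [Module K V]
    {ω : V →ₗ[K] V →ₗ[K] K} (halt : ω.IsAlt) {u v : V} (h : ω u v ≠ 0) :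
    ∃ g : V ≃ₗ[K] V, (∀ x y : V, ω (g x) (g y) = ω x y) ∧ g u = v := by
  have hvu : ω v u ≠ 0 := by
    rw [← halt.neg u v]
    exact neg_ne_zero.mpr h
  have hf : ((ω v u)⁻¹ • ω (v - u)) (v - u) = 0 := by
    rw [LinearMap.smul_apply, halt (v - u), smul_zero]
  refine ⟨LinearEquiv.transvection hf, fun x y => ?_, ?_⟩
  · generalize v - u = a at hf ⊢
    have hax : ω x a = -ω a x := (halt.neg a x).symm
    simp only [LinearEquiv.transvection.apply, map_add, map_smul, LinearMap.add_apply,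
      LinearMap.smul_apply, smul_eq_mul, halt a, hax]
    ring
  · rw [LinearEquiv.transvection.apply]
    simp [halt u, hvu]

/-- Two nonzero vectors have a common vector orthogonal to neither of them. -/
theorem exists_apply_ne_zero_and_apply_ne_zero
    {K V : Type*} [Field K] [AddCommGroup V] [Module K V]
    {ω : V →ₗ[K] V →ₗ[K] K} (hnd : ω.SeparatingLeft) {u v : V} (hu : u ≠ 0) (hv : v ≠ 0) :
    ∃ w : V, ω u w ≠ 0 ∧ ω v w ≠ 0 := by
  obtain ⟨y, hy⟩ := not_forall.mp (mt (hnd u) hu)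
  obtain ⟨z, hz⟩ := not_forall.mp (mt (hnd v) hv)
  by_cases hvy : ω v y = 0
  · by_cases huz : ω u z = 0
    · exact ⟨y + z, by simpa [huz] using hy, by simpa [hvy] using hz⟩
    · exact ⟨z, huz, hz⟩
  · exact ⟨y, hy, hvy⟩

/-- The symplectic group of a finite-dimensional symplectic space `(V, ω)` acts transitively
on nonzero vectors: for any nonzero `u, v` there is a linear automorphism `g` preserving `ω`
with `g u = v`. -/
theorem symplectic_transitive_on_nonzero_vectors
    {K V : Type*} [Field K] [AddCommGroup V] [Module K V] [FiniteDimensional K V]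
    (ω : V →ₗ[K] V →ₗ[K] K)
    (halt : ∀ x : V, ω x x = 0)
    (hnd : ∀ x : V, (∀ y : V, ω x y = 0) → x = 0)
    (u v : V) (hu : u ≠ 0) (hv : v ≠ 0) :
    ∃ g : V ≃ₗ[K] V, (∀ x y : V, ω (g x) (g y) = ω x y) ∧ g u = v := by
  have hω : ω.IsAlt := halt
  obtain ⟨w, huw, hvw⟩ := exists_apply_ne_zero_and_apply_ne_zero hnd hu hv
  have hwv : ω w v ≠ 0 := by
    rw [← hω.neg v w]
    exact neg_ne_zero.mpr hvw
  obtain ⟨g, hg, hgu⟩ := exists_isometry_of_apply_ne_zero hω huw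
  obtain ⟨k, hk, hkw⟩ := exists_isometry_of_apply_ne_zero hω hwv
  refine ⟨g.trans k, fun x y => ?_, ?_⟩
  · simp only [LinearEquiv.trans_apply, hk, hg]
  · rw [LinearEquiv.trans_apply, hgu, hkw]
end

section
/- Let K be a field and V a finite-dimensional K-vector space equipped with a nondegenerate alternating bilinear form ω (a symplectic space). Let k ≥ 1 and let (u₁, …, u_k) and (v₁, …, v_k) be two linearly independent families of vectors in V such that ω(u_i, u_j) = 0 and ω(v_i, v_j) = 0 for all 1 ≤ i, j ≤ k (i.e., each family spans a totally isotropic subspace). Then there exists a linear automorphism g of V preserving ω (ω(g x, g y) = ω(x, y) for all x, y) with g u_i = v_i for all i. In particular, the symplectic group acts transitively on linearly independent k-tuples spanning totally isotropic subspaces. -/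
namespace LinearMap.IsAlt

variable {K V : Type*} [Field K] [AddCommGroup V] [Module K V] {ω : V →ₗ[K] V →ₗ[K] K}

/-- A symplectic transvection maps `x` to `y` whenever `ω y x ≠ 0`, and fixes every vector
orthogonal to both `x` and `y`. -/
theorem exists_isometry_of_apply_ne_zero (hω : ω.IsAlt) {W : Submodule K V} {x y : V}
    (hx : ∀ w ∈ W, ω x w = 0) (hy : ∀ w ∈ W, ω y w = 0) (hyx : ω y x ≠ 0) :
    ∃ g : V ≃ₗ[K] V, (∀ a b, ω (g a) (g b) = ω a b) ∧ (∀ w ∈ W, g w = w) ∧ g x = y := by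
  have hf : ((ω y x)⁻¹ • ω (y - x)) (y - x) = 0 := by
    rw [LinearMap.smul_apply, hω.self_eq_zero, smul_zero]
  refine ⟨LinearEquiv.transvection hf, fun a b ↦ ?_, fun w hw ↦ ?_, ?_⟩
  · have hself := hω.self_eq_zero (y - x)
    have hswap := hω.neg a (y - x)
    simp only [LinearEquiv.transvection.apply, map_add, map_smul, LinearMap.add_apply,
      LinearMap.smul_apply, smul_eq_mul, hself, ← hswap]
    ring
  · simp [LinearMap.transvection.apply, hx w hw, hy w hw]
  · simp [LinearMap.transvection.apply, hω.self_eq_zero x, hyx]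

/-- A vector outside `W` is not orthogonal to some vector of the orthogonal complement of `W`. -/
theorem exists_apply_ne_zero_of_notMem [FiniteDimensional K V]
    (hnd : ω.SeparatingLeft) {W : Submodule K V} {x : V} (hx : x ∉ W) :
    ∃ z, (∀ w ∈ W, ω z w = 0) ∧ ω z x ≠ 0 := by
  obtain ⟨f, hfx, hfW⟩ := Submodule.exists_le_ker_of_notMem hx
  have hinj : Function.Injective ω :=
    LinearMap.ker_eq_bot.mp (LinearMap.separatingLeft_iff_ker_eq_bot.mp hnd)
  obtain ⟨z, rfl⟩ := (LinearMap.injective_iff_surjective_of_finrank_eq_finrank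
    Subspace.dual_finrank_eq.symm).mp hinj f
  exact ⟨z, fun w hw ↦ hfW hw, hfx⟩

/-- Two vectors outside `W` and orthogonal to `W` are related by an isometry fixing `W`
pointwise. -/
theorem exists_isometry_fixing_submodule [FiniteDimensional K V] (hω : ω.IsAlt)
    (hnd : ω.SeparatingLeft) {W : Submodule K V} {x y : V} (hxW : x ∉ W) (hyW : y ∉ W)
    (hx : ∀ w ∈ W, ω x w = 0) (hy : ∀ w ∈ W, ω y w = 0) :
    ∃ g : V ≃ₗ[K] V, (∀ a b, ω (g a) (g b) = ω a b) ∧ (∀ w ∈ W, g w = w) ∧ g x = y := by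
  obtain ⟨z, hz, hzx, hzy⟩ : ∃ z, (∀ w ∈ W, ω z w = 0) ∧ ω z x ≠ 0 ∧ ω z y ≠ 0 := by
    obtain ⟨p, hp, hpx⟩ := exists_apply_ne_zero_of_notMem hnd hxW
    obtain ⟨q, hq, hqy⟩ := exists_apply_ne_zero_of_notMem hnd hyW
    by_cases hpy : ω p y = 0
    · by_cases hqx : ω q x = 0
      · exact ⟨p + q, fun w hw ↦ by simp [hp w hw, hq w hw], by simpa [hqx], by simpa [hpy]⟩
      · exact ⟨q, hq, hqx, hqy⟩
    · exact ⟨p, hp, hpx, hpy⟩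
  have hyz : ω y z ≠ 0 := by rwa [← hω.neg z y, neg_ne_zero]
  obtain ⟨g, hg, hgW, rfl⟩ := hω.exists_isometry_of_apply_ne_zero hx hz hzx
  obtain ⟨h, hh, hhW, rfl⟩ := hω.exists_isometry_of_apply_ne_zero hz hy hyz
  exact ⟨g.trans h, fun a b ↦ by simp [hh, hg], fun w hw ↦ by simp [hgW w hw, hhW w hw], rfl⟩

end LinearMap.IsAlt


/-- The symplectic group of a finite-dimensional symplectic space `(V, ω)` acts transitively
on linearly independent `k`-tuples spanning totally isotropic subspaces: if `(u₁, …, u_k)` and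
`(v₁, …, v_k)` are linearly independent families with `ω(u_i, u_j) = 0` and `ω(v_i, v_j) = 0`
for all `i, j`, then some linear automorphism `g` preserving `ω` satisfies `g u_i = v_i`. -/
theorem symplectic_transitive_on_isotropic_tuples
    {K V : Type*} [Field K] [AddCommGroup V] [Module K V] [FiniteDimensional K V]
    (ω : V →ₗ[K] V →ₗ[K] K)
    (halt : ∀ x : V, ω x x = 0)
    (hnd : ∀ x : V, (∀ y : V, ω x y = 0) → x = 0)
    (k : ℕ) (hk : 1 ≤ k) (u v : Fin k → V)
    (hu : LinearIndependent K u) (hv : LinearIndependent K v)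
    (hiso_u : ∀ i j : Fin k, ω (u i) (u j) = 0)
    (hiso_v : ∀ i j : Fin k, ω (v i) (v j) = 0) :
    ∃ g : V ≃ₗ[K] V, (∀ x y : V, ω (g x) (g y) = ω x y) ∧ ∀ i : Fin k, g (u i) = v i := by
  have hω : ω.IsAlt := halt
  suffices H : ∀ n ≤ k, ∃ g : V ≃ₗ[K] V, (∀ x y : V, ω (g x) (g y) = ω x y) ∧
      ∀ i : Fin k, i.val < n → g (u i) = v i by
    obtain ⟨g, hg, hgu⟩ := H k le_rfl
    exact ⟨g, hg, fun i ↦ hgu i i.isLt⟩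
  intro n
  induction n with
  | zero => exact fun _ ↦ ⟨LinearEquiv.refl K V, by simp, by simp⟩
  | succ n ih =>
    intro hn
    obtain ⟨g, hg, hgu⟩ := ih (by lia)
    let j : Fin k := ⟨n, hn⟩
    let s : Set (Fin k) := {i | i.val < n}
    have hj : j ∉ s := lt_irrefl n
    have himage : (g ∘ u) '' s = v '' s := Set.image_congr hgu
    have hgu_li : LinearIndependent K (g ∘ u) := hu.map' g.toLinearMap g.ker
    have horth (x : V) (hx : ∀ i ∈ s, ω x (v i) = 0) :
        ∀ w ∈ Submodule.span K (v '' s), ω x w = 0 := by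
      have hle : Submodule.span K (v '' s) ≤ LinearMap.ker (ω x) :=
        Submodule.span_le.mpr (Set.image_subset_iff.mpr hx)
      exact fun w hw ↦ hle hw
    obtain ⟨h, hh, hhW, hhj⟩ := hω.exists_isometry_fixing_submodule hnd
      (himage ▸ hgu_li.notMem_span_image hj) (hv.notMem_span_image hj)
      (horth (g (u j)) fun i hi ↦ by rw [← hgu i hi, hg, hiso_u])
      (horth (v j) fun i _ ↦ hiso_v j i)
    refine ⟨g.trans h, fun x y ↦ by simp [hh, hg], fun i hi ↦ ?_⟩
    rcases Nat.lt_succ_iff_lt_or_eq.mp hi with hi | hi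
    · rw [LinearEquiv.trans_apply, hgu i hi]
      exact hhW _ (Submodule.subset_span (Set.mem_image_of_mem v hi))
    · obtain rfl : i = j := Fin.ext hi
      exact hhj
end
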